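/- Let S be a compact operator between Hilbert spaces and R an operator with ‖R‖ > ‖S‖ such that R − S has rank one. Then the maximizing subspace of R at its norm is one-dimensional; that is, the eigenspace of R*R corresponding to the eigenvalue ‖R‖² has dimension 1. -/

import Mathlib

/-- If `R` is a rank-one perturbation of a compact operator `S` and `‖R‖ > ‖S‖`, then
the maximizing subspace of `R`, i.e. the eigenspace of `R*R` for the eigenvalue `‖R‖²`,
is one-dimensional. -/
theorem stmt14 {H₁ H₂ : Type*}
    [NormedAddCommGroup H₁] [InnerProductSpace ℂ H₁] [CompleteSpace H₁]
    [NormedAddCommGroup H₂] [InnerProductSpace ℂ H₂] [CompleteSpace H₂]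
    (S R : H₁ →L[ℂ] H₂) (hS : IsCompactOperator ⇑S)
    (hrank : ∃ (a : H₁) (b : H₂), R = S + (innerSL ℂ a).smulRight b)
    (hnorm : ‖S‖ < ‖R‖) :
    Module.finrank ℂ
      (Module.End.eigenspace
        (((ContinuousLinearMap.adjoint R).comp R : H₁ →L[ℂ] H₁) : H₁ →ₗ[ℂ] H₁)
        ((‖R‖ : ℂ) ^ 2)) = 1 := by
  obtain ⟨a, b, hR⟩ := hrank
  have hRpos : 0 < ‖R‖ := lt_of_le_of_lt (norm_nonneg _) hnorm
  -- `R` is compact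
  have hRc : IsCompactOperator ⇑R := by
    have h1 : IsCompactOperator ⇑(innerSL ℂ a) :=
      isCompactOperator_of_locallyCompactSpace_dom (innerSL ℂ a)
    have h2 : IsCompactOperator (fun x : H₁ => (innerSL ℂ a x) • b) :=
      h1.continuous_comp (g := fun c : ℂ => c • b) (by fun_prop)
    have h3 := hS.add h2
    rw [hR]
    exact h3
  set T : H₁ →L[ℂ] H₁ := (ContinuousLinearMap.adjoint R).comp R with hT
  have hTc : IsCompactOperator ⇑T := hRc.clm_comp (ContinuousLinearMap.adjoint R)
  have hTnorm : ‖T‖ = ‖R‖ ^ 2 := by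
    rw [hT, ContinuousLinearMap.norm_adjoint_comp_self, sq]
  have hTnonneg : 0 ≤ T := by
    rw [ContinuousLinearMap.nonneg_iff_isPositive]
    exact ContinuousLinearMap.isPositive_adjoint_comp_self R
  have hnt : Nontrivial (H₁ →L[ℂ] H₁) := by
    refine ⟨⟨T, 0, fun h => ?_⟩⟩
    rw [h, norm_zero] at hTnorm
    exact (pow_pos hRpos 2).ne hTnorm
  -- the norm of `T` is an eigenvalue
  have hspec : ((‖R‖ : ℂ) ^ 2) ∈ spectrum ℂ T := by
    have h := spectrum.algebraMap_mem ℂ (CStarAlgebra.norm_mem_spectrum_of_nonneg (a := T) hTnonneg)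
    rw [hTnorm] at h
    simpa using h
  have hne : ((‖R‖ : ℂ) ^ 2) ≠ 0 := by
    simpa using norm_ne_zero_iff.mp hRpos.ne'
  obtain ⟨v, hv⟩ := ((IsCompactOperator.hasEigenvalue_iff_mem_spectrum hTc hne).2 hspec).exists_hasEigenvector
  -- the functional `⟪a, ·⟫` is injective on the eigenspace
  have hinj : ∀ w ∈ Module.End.eigenspace (T : H₁ →ₗ[ℂ] H₁) ((‖R‖ : ℂ) ^ 2),
      inner ℂ a w = 0 → w = 0 := by
    intro w hw haw
    rw [Module.End.mem_eigenspace_iff] at hw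
    have hTw : T w = ((‖R‖ : ℂ) ^ 2) • w := hw
    have hn : ‖R w‖ ^ 2 = ‖R‖ ^ 2 * ‖w‖ ^ 2 := by
      have h1 : inner ℂ (T w) w = inner ℂ (R w) (R w) := by
        simp [hT, ContinuousLinearMap.adjoint_inner_left]
      rw [hTw, inner_smul_left, inner_self_eq_norm_sq_to_K, inner_self_eq_norm_sq_to_K] at h1
      simp only [map_pow, Complex.conj_ofReal] at h1
      apply Complex.ofReal_injective
      push_cast
      exact h1.symm
    have hRS : R w = S w := by
      rw [hR]; simp [haw]
    have hle : ‖R w‖ ≤ ‖S‖ * ‖w‖ := hRS ▸ S.le_opNorm w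
    by_contra hw0
    have hwpos : 0 < ‖w‖ := norm_pos_iff.mpr hw0
    have hlt : ‖R w‖ < ‖R‖ * ‖w‖ := hle.trans_lt (by gcongr)
    have : ‖R w‖ ^ 2 < (‖R‖ * ‖w‖) ^ 2 := by gcongr
    rw [hn, mul_pow] at this
    exact lt_irrefl _ this
  have hav : inner ℂ a v ≠ 0 := fun h => hv.2 (hinj v hv.1 h)
  refine (finrank_eq_one_iff_of_nonzero' (⟨v, hv.1⟩ : Module.End.eigenspace (T : H₁ →ₗ[ℂ] H₁) _)
    (fun h => hv.2 (congrArg Subtype.val h))).2 ?_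
  rintro ⟨w, hw⟩
  refine ⟨inner ℂ a w / inner ℂ a v, Subtype.ext ?_⟩
  have h0 := hinj ((inner ℂ a w / inner ℂ a v) • v - w)
    (Submodule.sub_mem _ (Submodule.smul_mem _ _ hv.1) hw) (by
      rw [inner_sub_right, inner_smul_right, div_mul_cancel₀ _ hav, sub_self])
  exact sub_eq_zero.mp h0
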